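/- Let F = (P,Q) be a Keller map and let E ⊂ ℂ² be a finite union of images of polynomial maps γ_i(t) = (α_i(t), β_i(t)) with α_i, β_i nonconstant, such that the restriction of F from ℂ² \ F⁻¹(E) to ℂ² \ E is a covering map. Let c ∈ ℂ be such that the vertical line L_c = {(c,t) : t ∈ ℂ} meets E transversally in the following sense: for every i and every t₀ with α_i(t₀) = c one has α_i'(t₀) ≠ 0, and γ_i(t₀) ≠ γ_j(t₁) whenever (j,t₁) ≠ (i,t₀) with α_j(t₁) = c. Then P = c is a generic fiber of P: there is a finite set S ⊂ ℂ such that for every c' ∉ S the fiber {(x,y) ∈ ℂ² : P(x,y) = c'} is homeomorphic (in the subspace topology) to the fiber {(x,y) ∈ ℂ² : P(x,y) = c}. -/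

import Mathlib

open MvPolynomial Filter

/-- Evaluation of a bivariate polynomial at a point of `ℂ × ℂ`. -/
noncomputable def evalPoly (P : MvPolynomial (Fin 2) ℂ) (p : ℂ × ℂ) : ℂ :=
  MvPolynomial.eval ![p.1, p.2] P

/-- The polynomial map `ℂ² → ℂ²` given by a pair of polynomials. -/
noncomputable def polyMap (P Q : MvPolynomial (Fin 2) ℂ) (p : ℂ × ℂ) : ℂ × ℂ :=
  (evalPoly P p, evalPoly Q p)

/-- `(P, Q)` is a Keller map: the Jacobian determinant is a nonzero constant. -/
def IsKeller (P Q : MvPolynomial (Fin 2) ℂ) : Prop :=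
  ∃ c : ℂ, c ≠ 0 ∧
    pderiv 0 P * pderiv 1 Q - pderiv 1 P * pderiv 0 Q = MvPolynomial.C c

/-- `P` is a rational polynomial: away from finitely many values `c`, the fiber
`P = c` is homeomorphic to `ℂ` minus a finite set of points. -/
def IsRationalPoly (P : MvPolynomial (Fin 2) ℂ) : Prop :=
  ∃ S : Finset ℂ, ∀ c ∉ S, ∃ T : Finset ℂ,
    Nonempty ({p : ℂ × ℂ // evalPoly P p = c} ≃ₜ {z : ℂ // z ∉ T})

/-- The polynomial map `(P, Q)` has a polynomial inverse. -/
def IsInvertible (P Q : MvPolynomial (Fin 2) ℂ) : Prop :=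
  ∃ A B : MvPolynomial (Fin 2) ℂ,
    polyMap A B ∘ polyMap P Q = id ∧ polyMap P Q ∘ polyMap A B = id

/-- The non-proper value set of a map `F : ℂ² → ℂ²`. -/
def nonProperSet (F : ℂ × ℂ → ℂ × ℂ) : Set (ℂ × ℂ) :=
  {a | ∃ b : ℕ → ℂ × ℂ,
    Tendsto (fun i => ‖b i‖) atTop atTop ∧ Tendsto (fun i => F (b i)) atTop (nhds a)}

open Topology unitInterval

/-- The derivative of a polynomial function on `ℂ × ℂ`. -/
theorem hasStrictFDerivAt_evalPoly (P : MvPolynomial (Fin 2) ℂ) (p : ℂ × ℂ) :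
    HasStrictFDerivAt (evalPoly P)
      (evalPoly (pderiv 0 P) p • ContinuousLinearMap.fst ℂ ℂ ℂ +
        evalPoly (pderiv 1 P) p • ContinuousLinearMap.snd ℂ ℂ ℂ) p := by
  induction P using MvPolynomial.induction_on with
  | C a =>
    have : evalPoly (C a) = fun _ => a := by funext q; simp [evalPoly]
    rw [this]
    refine (hasStrictFDerivAt_const a p).congr_fderiv ?_
    ext <;> simp [evalPoly]
  | add f g hf hg =>
    have : evalPoly (f + g) = evalPoly f + evalPoly g := by funext q; simp [evalPoly]
    rw [this]
    refine (hf.add hg).congr_fderiv ?_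
    ext <;> simp [evalPoly]
  | mul_X f i hf =>
    fin_cases i
    · have : evalPoly (f * X 0) = fun q => evalPoly f q * q.1 := by
        funext q; simp [evalPoly]
      simp only [Fin.zero_eta, this]
      refine (hf.mul hasStrictFDerivAt_fst).congr_fderiv ?_
      ext <;> simp [evalPoly, pderiv_X]
    · have : evalPoly (f * X 1) = fun q => evalPoly f q * q.2 := by
        funext q; simp [evalPoly]
      simp only [Fin.mk_one, this]
      refine (hf.mul hasStrictFDerivAt_snd).congr_fderiv ?_
      ext <;> simp [evalPoly, pderiv_X]

theorem continuous_evalPoly (P : MvPolynomial (Fin 2) ℂ) : Continuous (evalPoly P) :=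
  continuous_iff_continuousAt.2 fun p => (hasStrictFDerivAt_evalPoly P p).continuousAt

/-- A Keller map has an invertible derivative everywhere, and the inverse of the derivative
depends continuously on the point. -/
theorem IsKeller.exists_hasStrictFDerivAt_equiv {P Q : MvPolynomial (Fin 2) ℂ}
    (h : IsKeller P Q) :
    ∃ F' : ℂ × ℂ → ((ℂ × ℂ) ≃L[ℂ] (ℂ × ℂ)),
      (∀ p, HasStrictFDerivAt (polyMap P Q) (F' p : (ℂ × ℂ) →L[ℂ] (ℂ × ℂ)) p) ∧
      Continuous fun q : (ℂ × ℂ) × (ℂ × ℂ) => (F' q.1).symm q.2 := by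
  obtain ⟨k, hk, hJ⟩ := h
  have hJ' (p : ℂ × ℂ) : evalPoly (pderiv 0 P) p * evalPoly (pderiv 1 Q) p -
      evalPoly (pderiv 1 P) p * evalPoly (pderiv 0 Q) p = k := by
    simpa [evalPoly] using congrArg (evalPoly · p) hJ
  let D (p : ℂ × ℂ) : (ℂ × ℂ) →L[ℂ] (ℂ × ℂ) :=
    (evalPoly (pderiv 0 P) p • ContinuousLinearMap.fst ℂ ℂ ℂ +
      evalPoly (pderiv 1 P) p • ContinuousLinearMap.snd ℂ ℂ ℂ).prod
    (evalPoly (pderiv 0 Q) p • ContinuousLinearMap.fst ℂ ℂ ℂ +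
      evalPoly (pderiv 1 Q) p • ContinuousLinearMap.snd ℂ ℂ ℂ)
  let D' (p : ℂ × ℂ) : (ℂ × ℂ) →L[ℂ] (ℂ × ℂ) :=
    ((k⁻¹ * evalPoly (pderiv 1 Q) p) • ContinuousLinearMap.fst ℂ ℂ ℂ -
      (k⁻¹ * evalPoly (pderiv 1 P) p) • ContinuousLinearMap.snd ℂ ℂ ℂ).prod
    ((k⁻¹ * evalPoly (pderiv 0 P) p) • ContinuousLinearMap.snd ℂ ℂ ℂ -
      (k⁻¹ * evalPoly (pderiv 0 Q) p) • ContinuousLinearMap.fst ℂ ℂ ℂ)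
  refine ⟨fun p => ContinuousLinearEquiv.equivOfInverse (D p) (D' p) ?_ ?_, fun p => ?_, ?_⟩
  · rintro ⟨u, v⟩
    ext
    · simp only [D, D', ContinuousLinearMap.prod_apply, add_apply, sub_apply, smul_apply,
        ContinuousLinearMap.coe_fst', ContinuousLinearMap.coe_snd', smul_eq_mul]
      field_simp
      linear_combination u * hJ' p
    · simp only [D, D', ContinuousLinearMap.prod_apply, add_apply, sub_apply, smul_apply,
        ContinuousLinearMap.coe_fst', ContinuousLinearMap.coe_snd', smul_eq_mul]
      field_simp
      linear_combination v * hJ' p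
  · rintro ⟨u, v⟩
    ext
    · simp only [D, D', ContinuousLinearMap.prod_apply, add_apply, sub_apply, smul_apply,
        ContinuousLinearMap.coe_fst', ContinuousLinearMap.coe_snd', smul_eq_mul]
      field_simp
      linear_combination u * hJ' p
    · simp only [D, D', ContinuousLinearMap.prod_apply, add_apply, sub_apply, smul_apply,
        ContinuousLinearMap.coe_fst', ContinuousLinearMap.coe_snd', smul_eq_mul]
      field_simp
      linear_combination v * hJ' p
  · exact (hasStrictFDerivAt_evalPoly P p).prodMk (hasStrictFDerivAt_evalPoly Q p)
  · have h00 := continuous_evalPoly (pderiv 0 P)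
    have h10 := continuous_evalPoly (pderiv 1 P)
    have h01 := continuous_evalPoly (pderiv 0 Q)
    have h11 := continuous_evalPoly (pderiv 1 Q)
    have hD' : Continuous fun q : (ℂ × ℂ) × (ℂ × ℂ) => D' q.1 q.2 := by
      simp only [D', ContinuousLinearMap.prod_apply, sub_apply, smul_apply,
        ContinuousLinearMap.coe_fst', ContinuousLinearMap.coe_snd', smul_eq_mul]
      generalize evalPoly (pderiv 0 P) = a at *
      generalize evalPoly (pderiv 1 P) = b at *
      generalize evalPoly (pderiv 0 Q) = c at *
      generalize evalPoly (pderiv 1 Q) = d at *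
      clear D D' hJ hJ'
      fun_prop
    exact hD'

theorem isLocalHomeomorph_of_hasStrictFDerivAt_equiv {F : ℂ × ℂ → ℂ × ℂ}
    {F' : ℂ × ℂ → ((ℂ × ℂ) ≃L[ℂ] (ℂ × ℂ))}
    (hF : ∀ p, HasStrictFDerivAt F (F' p : (ℂ × ℂ) →L[ℂ] (ℂ × ℂ)) p) : IsLocalHomeomorph F :=
  .mk F fun p => ⟨(hF p).toOpenPartialHomeomorph F,
    (hF p).mem_toOpenPartialHomeomorph_source, fun _ _ => rfl⟩

/-- Homotopies lift through a separated local homeomorphism as soon as each individual path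
lifts. -/
theorem IsLocalHomeomorph.exists_lift_homotopy {X B A : Type*} [TopologicalSpace X]
    [TopologicalSpace B] [TopologicalSpace A] [T2Space X] {f : X → B}
    (hf : IsLocalHomeomorph f) (H : C(I × A, B)) {G₀ : A → X} (hG₀ : Continuous G₀)
    (hlift : ∀ a, ∃ γ : C(I, X), γ 0 = G₀ a ∧ ∀ s, f (γ s) = H (s, a)) :
    ∃ G : I × A → X, Continuous G ∧ (∀ a, G (0, a) = G₀ a) ∧ ∀ q, f (G q) = H q := by
  choose γ hγ0 hγ using hlift
  refine ⟨fun q => γ q.2 q.1, ?_, fun a => hγ0 a, fun q => hγ q.2 q.1⟩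
  refine hf.continuous_lift (T2Space.isSeparatedMap f) H ?_ ?_ fun a => ?_
  · funext q; exact hγ q.2 q.1
  · simpa only [hγ0] using hG₀
  · exact (γ a).continuous

/-- Two lifts of the same path through a separated local homeomorphism agree if they agree
at one point. -/
theorem IsLocalHomeomorph.lift_unique {X B A : Type*} [TopologicalSpace X]
    [TopologicalSpace B] [TopologicalSpace A] [PreconnectedSpace A] [T2Space X] {f : X → B}
    (hf : IsLocalHomeomorph f) {g₁ g₂ : A → X} (h₁ : Continuous g₁) (h₂ : Continuous g₂)
    (h : ∀ a, f (g₁ a) = f (g₂ a)) (a : A) (ha : g₁ a = g₂ a) (b : A) : g₁ b = g₂ b :=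
  congrFun ((T2Space.isSeparatedMap f).eq_of_comp_eq hf.isLocallyInjective h₁ h₂
    (funext h) a ha) b

/-- Transport of fibers: if `Γ` is a homotopy all of whose paths lift, forwards and backwards,
through a separated local homeomorphism `f`, then the preimages of the two ends of `Γ` are
homeomorphic. -/
theorem IsLocalHomeomorph.nonempty_homeomorph_of_lift {X B Y : Type*} [TopologicalSpace X]
    [TopologicalSpace B] [TopologicalSpace Y] [T2Space X] {f : X → B}
    (hf : IsLocalHomeomorph f) (Γ : C(I × Y, B)) {s₀ s₁ : Set X}
    (q₀ : C(s₀, Y)) (q₁ : C(s₁, Y))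
    (hq₀ : ∀ p, Γ (0, q₀ p) = f p) (hq₁ : ∀ p, Γ (1, q₁ p) = f p)
    (hs₀ : ∀ p y, f p = Γ (0, y) → p ∈ s₀) (hs₁ : ∀ p y, f p = Γ (1, y) → p ∈ s₁)
    (hi₀ : ∀ y y', Γ (0, y) = Γ (0, y') → y = y') (hi₁ : ∀ y y', Γ (1, y) = Γ (1, y') → y = y')
    (hfwd : ∀ y p, f p = Γ (0, y) → ∃ γ : C(I, X), γ 0 = p ∧ ∀ s, f (γ s) = Γ (s, y))
    (hbwd : ∀ y p, f p = Γ (1, y) → ∃ γ : C(I, X), γ 0 = p ∧ ∀ s, f (γ s) = Γ (σ s, y)) :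
    Nonempty (s₀ ≃ₜ s₁) := by
  obtain ⟨G, hG, hG0, hfG⟩ := hf.exists_lift_homotopy
    (Γ.comp ⟨fun q : I × s₀ => (q.1, q₀ q.2), by fun_prop⟩) (G₀ := fun p : s₀ => (p : X))
    continuous_subtype_val (fun p => hfwd _ _ (hq₀ p).symm)
  obtain ⟨K, hK, hK0, hfK⟩ := hf.exists_lift_homotopy
    (Γ.comp ⟨fun q : I × s₁ => (σ q.1, q₁ q.2), by fun_prop⟩) (G₀ := fun p : s₁ => (p : X))
    continuous_subtype_val (fun p => hbwd _ _ (hq₁ p).symm)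
  simp only [ContinuousMap.comp_apply, ContinuousMap.coe_mk] at hfG hfK
  have hG1 (p : s₀) : G (1, p) ∈ s₁ := hs₁ _ _ (hfG _)
  have hK1 (p : s₁) : K (1, p) ∈ s₀ := hs₀ _ (q₁ p) (by simpa using hfK (1, p))
  have eG (p : s₀) : q₁ ⟨G (1, p), hG1 p⟩ = q₀ p :=
    hi₁ _ _ ((hq₁ _).trans (hfG (1, p)))
  have eK (p : s₁) : q₀ ⟨K (1, p), hK1 p⟩ = q₁ p :=
    hi₀ _ _ ((hq₀ _).trans (by simpa using hfK (1, p)))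
  refine ⟨⟨⟨fun p => ⟨G (1, p), hG1 p⟩, fun p => ⟨K (1, p), hK1 p⟩, fun p => ?_, fun p => ?_⟩,
    by fun_prop, by fun_prop⟩⟩
  · have := hf.lift_unique (g₁ := fun s : I => K (s, ⟨G (1, p), hG1 p⟩))
      (g₂ := fun s : I => G (σ s, p)) (by fun_prop) (by fun_prop)
      (fun s => by rw [hfK, hfG, eG]) 0 (by simp [hK0]) 1
    ext
    simp only [this, symm_one, hG0]
  · have := hf.lift_unique (g₁ := fun s : I => G (s, ⟨K (1, p), hK1 p⟩))
      (g₂ := fun s : I => K (σ s, p)) (by fun_prop) (by fun_prop)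
      (fun s => by rw [hfK, hfG, eK, symm_symm]) 0 (by simp [hG0]) 1
    ext
    simp only [this, symm_one, hK0]

/-- A path avoiding `E` lifts through a map restricting to a covering map over the complement
of `E`. -/
theorem exists_lift_of_isCoveringMap_compl {X B : Type*} [TopologicalSpace X]
    [TopologicalSpace B] {f : X → B} {E : Set B}
    (hcov : IsCoveringMap fun p : (f ⁻¹' Eᶜ : Set X) => (⟨f p.1, p.2⟩ : (Eᶜ : Set B)))
    (γ : C(I, B)) (hγ : ∀ s, γ s ∉ E) (p : X) (hp : f p = γ 0) :
    ∃ γ' : C(I, X), γ' 0 = p ∧ ∀ s, f (γ' s) = γ s := by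
  obtain ⟨Γ, h1, h2⟩ := hcov.exists_path_lifts ⟨fun s => ⟨γ s, hγ s⟩, by fun_prop⟩
    ⟨p, by simpa [hp] using hγ 0⟩ (Subtype.ext hp.symm)
  refine ⟨⟨fun s => Γ s, by fun_prop⟩, by simp [h2], fun s => ?_⟩
  exact congrArg Subtype.val (congrFun h1 s)

theorem differentiableOn_intervalIntegral_of_continuousOn_deriv {V : Type*}
    [NormedAddCommGroup V] [NormedSpace ℂ V] {U : Set ℂ} (hU : IsOpen U)
    {T T' : ℂ → ℝ → V} (hT : ContinuousOn (Function.uncurry T) (U ×ˢ Set.univ))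
    (hT' : ContinuousOn (Function.uncurry T') (U ×ˢ Set.univ))
    (hd : ∀ x ∈ U, ∀ θ, HasDerivAt (fun x => T x θ) (T' x θ) x) (a b : ℝ) :
    DifferentiableOn ℂ (fun x => ∫ θ in a..b, T x θ) U := by
  intro x hx
  obtain ⟨ε, hε, hεU⟩ := Metric.nhds_basis_closedBall.mem_iff.1 (hU.mem_nhds hx)
  have hc {S : ℂ → ℝ → V} (hS : ContinuousOn (Function.uncurry S) (U ×ˢ Set.univ)) {y : ℂ}
      (hy : y ∈ U) : Continuous (S y) :=
    hS.comp_continuous (f := fun θ : ℝ => (y, θ)) (by fun_prop) fun θ => ⟨hy, trivial⟩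
  obtain ⟨C, hC⟩ := ((isCompact_closedBall x ε).prod
    (isCompact_uIcc (a := a) (b := b))).exists_bound_of_continuousOn
    (hT'.mono (Set.prod_mono hεU (Set.subset_univ _)))
  have := intervalIntegral.hasDerivAt_integral_of_dominated_loc_of_deriv_le
    (μ := MeasureTheory.volume) (F := T) (F' := T') (x₀ := x) (a := a) (b := b)
    (bound := fun _ => C) (Metric.closedBall_mem_nhds x hε)
    ((hU.eventually_mem hx).mono fun y hy => (hc hT hy).aestronglyMeasurable)
    ((hc hT hx).intervalIntegrable _ _) (hc hT' hx).aestronglyMeasurable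
    (.of_forall fun θ hθ y hy => hC (y, θ) ⟨hy, Set.uIoc_subset_uIcc hθ⟩)
    intervalIntegrable_const (.of_forall fun θ _ y hy => hd y (hεU hy) θ)
  exact this.2.differentiableAt.differentiableWithinAt

/-- A lift of a point on the graph of a holomorphic function `g` extends to a lift of the whole
graph, provided paths in a punctured neighborhood of the graph lift. -/
theorem exists_lift_graph {F : ℂ × ℂ → ℂ × ℂ} {F' : ℂ × ℂ → ((ℂ × ℂ) ≃L[ℂ] (ℂ × ℂ))}
    (hF : ∀ p, HasStrictFDerivAt F (F' p : (ℂ × ℂ) →L[ℂ] (ℂ × ℂ)) p)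
    (hF' : Continuous fun q : (ℂ × ℂ) × (ℂ × ℂ) => (F' q.1).symm q.2) {E : Set (ℂ × ℂ)}
    (hlift : ∀ γ : C(I, ℂ × ℂ), (∀ s, γ s ∉ E) → ∀ p, F p = γ 0 →
      ∃ γ' : C(I, ℂ × ℂ), γ' 0 = p ∧ ∀ s, F (γ' s) = γ s)
    {U : Set ℂ} (hU : IsOpen U) (hUc : Convex ℝ U) {g : ℂ → ℂ} (hg : DifferentiableOn ℂ g U)
    {δ : ℝ} (hδ : 0 < δ) (hE : ∀ x ∈ U, ∀ w, w ≠ 0 → ‖w‖ < δ → (x, g x + w) ∉ E)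
    {x₀ : ℂ} (hx₀ : x₀ ∈ U) {p₀ : ℂ × ℂ} (hp₀ : F p₀ = (x₀, g x₀)) :
    ∃ τ : ℂ → ℂ × ℂ, ContinuousOn τ U ∧ τ x₀ = p₀ ∧ ∀ x ∈ U, F (τ x) = (x, g x) := by
  have hloc := isLocalHomeomorph_of_hasStrictFDerivAt_equiv hF
  set e := (hF p₀).toOpenPartialHomeomorph F with he
  have hes : ∀ y ∈ e.target, F (e.symm y) = y := fun y hy => e.right_inv hy
  have hp₀t : (x₀, g x₀) ∈ e.target := hp₀ ▸ (hF p₀).image_mem_toOpenPartialHomeomorph_target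
  have hep₀ : e.symm (x₀, g x₀) = p₀ := by
    rw [← hp₀]; exact e.left_inv (hF p₀).mem_toOpenPartialHomeomorph_source
  have hΦ : ContinuousAt (fun q : ℂ × ℂ => (q.1, g q.1 + q.2)) (x₀, 0) := by
    have : ContinuousAt (fun q : ℂ × ℂ => g q.1) (x₀, 0) :=
      ContinuousAt.comp (f := Prod.fst) (x := (x₀, (0 : ℂ)))
        (hg.continuousOn.continuousAt (hU.mem_nhds hx₀)) continuousAt_fst
    exact continuousAt_fst.prodMk (this.add continuousAt_snd)
  obtain ⟨ε, hε, hεs⟩ : ∃ ε > 0, ∀ x ∈ Metric.ball x₀ ε, x ∈ U ∧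
      ∀ w : ℂ, ‖w‖ < ε → (x, g x + w) ∈ e.target := by
    have h1 := hΦ.preimage_mem_nhds (e.open_target.mem_nhds (by simpa using hp₀t))
    have h2 : ∀ᶠ q : ℂ × ℂ in 𝓝 (x₀, 0), q.1 ∈ U :=
      continuousAt_fst.eventually_mem (hU.mem_nhds hx₀)
    obtain ⟨ε, hε, h⟩ := Metric.mem_nhds_iff.1 (Filter.inter_mem h1 h2)
    refine ⟨ε, hε, fun x hx => ⟨(@h (x, 0) ?_).2, fun w hw => (@h (x, w) ?_).1⟩⟩
    · rw [← ball_prod_same]; exact ⟨hx, Metric.mem_ball_self hε⟩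
    · rw [← ball_prod_same]; exact ⟨hx, by simpa using hw⟩
  obtain ⟨r, hr, hrε, hrδ⟩ : ∃ r > 0, r < ε ∧ r < δ :=
    ⟨min ε δ / 2, by positivity, by linarith [min_le_left ε δ, lt_min hε hδ],
      by linarith [min_le_right ε δ, lt_min hε hδ]⟩
  have hcn (θ : ℝ) : ‖circleMap 0 r θ‖ = r := by simp [abs_of_pos hr]
  have hz (C : Set ℂ) (hC : Convex ℝ C) (h0 : x₀ ∈ C) (s : I) (x : ℂ) (hx : x ∈ C) :
      x₀ + (s : ℝ) • (x - x₀) ∈ C := hC.add_smul_sub_mem h0 hx s.2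
  have hH : Continuous fun q : I × (U × ℝ) =>
      (x₀ + (q.1 : ℝ) • ((q.2.1 : ℂ) - x₀),
        g (x₀ + (q.1 : ℝ) • ((q.2.1 : ℂ) - x₀)) + circleMap 0 r q.2.2) := by
    have : Continuous fun q : I × (U × ℝ) => g (x₀ + (q.1 : ℝ) • ((q.2.1 : ℂ) - x₀)) :=
      hg.continuousOn.comp_continuous (by fun_prop) fun q => hz U hUc hx₀ _ _ q.2.1.2
    exact Continuous.prodMk (by fun_prop)
      (this.add ((continuous_circleMap 0 r).comp (by fun_prop)))
  have hG₀ : Continuous fun a : U × ℝ => e.symm (x₀, g x₀ + circleMap 0 r a.2) :=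
    e.continuousOn_symm.comp_continuous (by fun_prop) fun a =>
      (hεs x₀ (Metric.mem_ball_self hε)).2 _ (by rw [hcn]; exact hrε)
  obtain ⟨G, hG, hG0, hFG⟩ := hloc.exists_lift_homotopy ⟨_, hH⟩ hG₀ (fun a => by
    refine hlift ⟨fun s => _, hH.comp (Continuous.prodMk_left a)⟩ (fun s => ?_) _ ?_
    · exact hE _ (hz U hUc hx₀ _ _ a.1.2) _ (by simp [hr.ne']) (by rw [hcn]; exact hrδ)
    · rw [hes _ ((hεs x₀ (Metric.mem_ball_self hε)).2 _ (by rw [hcn]; exact hrε))]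
      simp)
  simp only [ContinuousMap.coe_mk] at hFG
  have hGe (x : U) (hx : (x : ℂ) ∈ Metric.ball x₀ ε) (θ : ℝ) :
      G (1, (x, θ)) = e.symm ((x : ℂ), g x + circleMap 0 r θ) := by
    have hm (s : I) := (hεs _ (hz _ (convex_ball x₀ ε) (Metric.mem_ball_self hε) s x hx)).2
      (circleMap 0 r θ) (by rw [hcn]; exact hrε)
    have := hloc.lift_unique (g₁ := fun s : I => G (s, (x, θ))) (g₂ := fun s : I =>
      e.symm (x₀ + (s : ℝ) • ((x : ℂ) - x₀),
        g (x₀ + (s : ℝ) • ((x : ℂ) - x₀)) + circleMap 0 r θ)) (by fun_prop)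
      (e.continuousOn_symm.comp_continuous (hH.comp (Continuous.prodMk_left (x, θ))) hm)
      (fun s => by rw [hFG, hes _ (hm s)]) 0 (by simp [hG0]) 1
    simpa using this
  classical
  let T (x : ℂ) (θ : ℝ) : ℂ × ℂ := if h : x ∈ U then G (1, (⟨x, h⟩, θ)) else 0
  have hFT (x : ℂ) (hx : x ∈ U) (θ : ℝ) : F (T x θ) = (x, g x + circleMap 0 r θ) := by
    simp [T, hx, hFG]
  have hT : ContinuousOn (Function.uncurry T) (U ×ˢ Set.univ) := by
    rw [continuousOn_iff_continuous_domRestrict]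
    have : (U ×ˢ Set.univ).domRestrict (Function.uncurry T) =
        fun q => G (1, (⟨q.1.1, q.2.1⟩, q.1.2)) := by
      funext q
      simp [T, Function.uncurry, q.2.1]
    rw [this]
    fun_prop
  let T' (x : ℂ) (θ : ℝ) : ℂ × ℂ := (F' (T x θ)).symm (1, deriv g x)
  have hT' : ContinuousOn (Function.uncurry T') (U ×ˢ Set.univ) := by
    have h1 : ContinuousOn (fun q : ℂ × ℝ => deriv g q.1) (U ×ˢ Set.univ) :=
      (hg.deriv hU).continuousOn.comp continuousOn_fst fun q hq => hq.1
    exact hF'.comp_continuousOn (hT.prodMk (continuousOn_const.prodMk h1))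
  have hd : ∀ x ∈ U, ∀ θ, HasDerivAt (fun x => T x θ) (T' x θ) x := by
    intro x hx θ
    have h1 : HasDerivAt (fun y => (y, g y + circleMap 0 r θ)) (1, deriv g x) x :=
      (hasDerivAt_id x).prodMk (((hg x hx).differentiableAt (hU.mem_nhds hx)).hasDerivAt.add_const _)
    have h2 := (hF (T x θ)).to_localInverse.hasFDerivAt
    rw [hFT x hx] at h2
    refine (h2.comp_hasDerivAt x h1).congr_of_eventuallyEq ?_
    have hc : ContinuousAt (fun y => T y θ) x :=
      ContinuousAt.comp (g := Function.uncurry T) (f := fun y => (y, θ))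
        (hT.continuousAt (prod_mem_nhds (hU.mem_nhds hx) Filter.univ_mem)) (by fun_prop)
    filter_upwards [hc.eventually (hF (T x θ)).eventually_left_inverse, hU.eventually_mem hx]
      with y hy hyU
    rw [Function.comp_apply, ← hFT y hyU, hy]
  let τ : ℂ → ℂ × ℂ := (2 * Real.pi)⁻¹ • fun x => ∫ θ in 0..2 * Real.pi, T x θ
  have hτd : DifferentiableOn ℂ τ U :=
    (differentiableOn_intervalIntegral_of_continuousOn_deriv hU hT hT' hd _ _).const_smul _
  have hτe (x : ℂ) (hx : x ∈ Metric.ball x₀ ε) : τ x = e.symm (x, g x) := by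
    have hxU := (hεs x hx).1
    have h1 : τ x = Real.circleAverage (fun w => e.symm (x, g x + w)) 0 r := by
      simp only [τ, Pi.smul_apply, Real.circleAverage, T, hxU, dif_pos, hGe ⟨x, hxU⟩ hx]
    rw [h1, DiffContOnCl.circleAverage, add_zero]
    refine DifferentiableOn.diffContOnCl fun w hw => ?_
    have hw' : ‖w‖ < ε := by
      have := Metric.closure_ball_subset_closedBall hw
      rw [abs_of_pos hr, mem_closedBall_zero_iff] at this
      linarith
    have h3 := e.hasFDerivAt_symm ((hεs x hx).2 w hw') (hF _).hasFDerivAt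
    have h4 : DifferentiableAt ℂ (fun w : ℂ => (x, g x + w)) w := by fun_prop
    exact (h3.differentiableAt.comp w h4).differentiableWithinAt
  have hFd : Differentiable ℂ F := fun p => (hF p).hasFDerivAt.differentiableAt
  refine ⟨τ, hτd.continuousOn, (hτe x₀ (Metric.mem_ball_self hε)).trans hep₀, ?_⟩
  refine AnalyticOnNhd.eqOn_of_preconnected_of_eventuallyEq
    ((hFd.comp_differentiableOn hτd).analyticOnNhd hU)
    ((differentiableOn_id.prodMk hg).analyticOnNhd hU) hUc.isPreconnected hx₀ ?_
  filter_upwards [Metric.ball_mem_nhds x₀ hε] with x hx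
  have := (hεs x hx).2 0 (by simpa using hε)
  rw [add_zero] at this
  simp only [hτe x hx, hes _ this]

/-- A Lipschitz perturbation of the identity with constant `1 / 2` is a homeomorphism. -/
theorem exists_homeomorph_add_of_norm_sub_le {V : Type*} [NormedAddCommGroup V]
    [NormedSpace ℂ V] [CompleteSpace V] {u : V → V}
    (hu : ∀ y y', ‖u y - u y'‖ ≤ 1 / 2 * ‖y - y'‖) : ∃ h : V ≃ₜ V, ∀ y, h y = y + u y := by
  have hA : ApproximatesLinearOn (fun y => y + u y)
      ((ContinuousLinearEquiv.refl ℂ V : V ≃L[ℂ] V) : V →L[ℂ] V) Set.univ (1 / 2) := by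
    intro y _ y' _
    have : y + u y - (y' + u y') - (y - y') = u y - u y' := by abel
    simpa [this] using hu y y'
  refine ⟨hA.toHomeomorph _ ?_, fun y => rfl⟩
  rcases subsingleton_or_nontrivial V with h | h
  · exact Or.inl h
  · refine Or.inr ?_
    have : ‖(((ContinuousLinearEquiv.refl ℂ V).symm : V ≃L[ℂ] V) : V →L[ℂ] V)‖₊ = 1 :=
      NNReal.eq (ContinuousLinearMap.norm_id (𝕜 := ℂ) (E := V))
    rw [this, ← NNReal.coe_lt_coe]
    norm_num

/-- Tent functions centred at separated points `y r` move these points to any nearby points `v r`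
by a homeomorphism. -/
theorem tent_homeomorph {R : Type*} [Fintype R] {y : R → ℂ} {δ : ℝ} (hδ : 0 < δ)
    (hy : ∀ r s, r ≠ s → δ ≤ ‖y r - y s‖) {v : R → ℂ}
    (hv : ∀ r, ‖v r - y r‖ ≤ δ / (4 * (Fintype.card R + 1))) :
    (∃ h : ℂ ≃ₜ ℂ, ∀ t, h t = t + ∑ r, ((max 0 (1 - ‖t - y r‖ / δ) : ℝ) : ℂ) * (v r - y r)) ∧
      ∀ s, y s + ∑ r, ((max 0 (1 - ‖y s - y r‖ / δ) : ℝ) : ℂ) * (v r - y r) = v s := by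
  constructor
  · refine exists_homeomorph_add_of_norm_sub_le fun t t' => ?_
    have hρ (r : R) : |max 0 (1 - ‖t - y r‖ / δ) - max 0 (1 - ‖t' - y r‖ / δ)| ≤
        ‖t - t'‖ / δ := by
      rw [max_comm 0, max_comm 0]
      refine (abs_max_sub_max_le_abs _ _ _).trans ?_
      have h1 : (1 - ‖t - y r‖ / δ) - (1 - ‖t' - y r‖ / δ) =
          (‖t' - y r‖ - ‖t - y r‖) / δ := by ring
      rw [h1, abs_div, abs_of_pos hδ]
      gcongr
      refine (abs_norm_sub_norm_le _ _).trans_eq ?_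
      rw [norm_sub_rev]; congr 1; ring
    rw [← Finset.sum_sub_distrib]
    calc ‖∑ r, (((max 0 (1 - ‖t - y r‖ / δ) : ℝ) : ℂ) * (v r - y r) -
            ((max 0 (1 - ‖t' - y r‖ / δ) : ℝ) : ℂ) * (v r - y r))‖
        ≤ ∑ r : R, ‖t - t'‖ / δ * (δ / (4 * (Fintype.card R + 1))) := by
          refine norm_sum_le_of_le _ fun r _ => ?_
          rw [← sub_mul, norm_mul, ← Complex.ofReal_sub, Complex.norm_real, Real.norm_eq_abs]
          exact mul_le_mul (hρ r) (hv r) (norm_nonneg _) (by positivity)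
      _ = (Fintype.card R / (4 * (Fintype.card R + 1))) * ‖t - t'‖ := by
          rw [Finset.sum_const, Finset.card_univ, nsmul_eq_mul]
          field_simp
      _ ≤ 1 / 2 * ‖t - t'‖ := by
          refine mul_le_mul_of_nonneg_right ?_ (norm_nonneg _)
          rw [div_le_div_iff₀ (by positivity) (by positivity)]
          have : (0 : ℝ) ≤ Fintype.card R := by positivity
          linarith
  · intro s
    rw [Finset.sum_eq_single s]
    · simp
    · intro r _ hr
      have : max 0 (1 - ‖y s - y r‖ / δ) = 0 := by
        refine max_eq_left ?_
        rw [sub_nonpos, le_div_iff₀ hδ, one_mul]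
        exact hy s r hr.symm
      simp [this]
    · simp

/-- Local constancy of the fibers of the first component of `F` near a value over which the
branch curve `E` is a disjoint union of graphs. -/
theorem eventually_nonempty_homeomorph_fiber {F : ℂ × ℂ → ℂ × ℂ}
    {F' : ℂ × ℂ → ((ℂ × ℂ) ≃L[ℂ] (ℂ × ℂ))}
    (hF : ∀ p, HasStrictFDerivAt F (F' p : (ℂ × ℂ) →L[ℂ] (ℂ × ℂ)) p)
    (hF' : Continuous fun q : (ℂ × ℂ) × (ℂ × ℂ) => (F' q.1).symm q.2) {E : Set (ℂ × ℂ)}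
    (hlift : ∀ γ : C(I, ℂ × ℂ), (∀ s, γ s ∉ E) → ∀ p, F p = γ 0 →
      ∃ γ' : C(I, ℂ × ℂ), γ' 0 = p ∧ ∀ s, F (γ' s) = γ s)
    {R : Type*} [Finite R] {g : R → ℂ → ℂ} {c : ℂ}
    (hg : ∀ r, ∀ᶠ x in 𝓝 c, DifferentiableAt ℂ (g r) x)
    (hE : ∀ᶠ x in 𝓝 c, ∀ y, (x, y) ∈ E ↔ ∃ r, y = g r x)
    (hsep : Function.Injective fun r => g r c) :
    ∀ᶠ c' in 𝓝 c, Nonempty ({p | (F p).1 = c} ≃ₜ {p | (F p).1 = c'}) := by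
  have := Fintype.ofFinite R
  have hloc := isLocalHomeomorph_of_hasStrictFDerivAt_equiv hF
  have hFc : Continuous F := hloc.continuous
  obtain ⟨δ, hδ, hδs⟩ : ∃ δ > 0, ∀ r s, r ≠ s → δ ≤ ‖g r c - g s c‖ := by
    have h : ∀ q : R × R, ∀ᶠ δ in 𝓝[>] (0 : ℝ), q.1 ≠ q.2 → δ ≤ ‖g q.1 c - g q.2 c‖ := by
      intro q
      by_cases hq : q.1 = q.2
      · simp [hq]
      · have : 0 < ‖g q.1 c - g q.2 c‖ := norm_pos_iff.2 (sub_ne_zero.2 (hsep.ne hq))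
        filter_upwards [Ioo_mem_nhdsGT this] with δ hδ _ using hδ.2.le
    obtain ⟨δ, h1, h2⟩ := ((eventually_all.2 h).and self_mem_nhdsWithin).exists
    exact ⟨δ, h2, fun r s => h1 (r, s)⟩
  set η := δ / (4 * (Fintype.card R + 1)) with hη
  have hη0 : 0 < η := by positivity
  have hη4 : η ≤ δ / 4 := by
    rw [hη]
    gcongr
    have : (0 : ℝ) ≤ Fintype.card R := by positivity
    linarith
  have hgη : ∀ᶠ x in 𝓝 c, ∀ r, ‖g r x - g r c‖ ≤ η := by
    refine eventually_all.2 fun r => ?_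
    have h1 : ContinuousAt (fun x => ‖g r x - g r c‖) c :=
      ((hg r).self_of_nhds.continuousAt.sub continuousAt_const).norm
    exact (h1.eventually_lt continuousAt_const (by simpa using hη0)).mono fun _ h => h.le
  obtain ⟨ε, hε, hεs⟩ := Metric.eventually_nhds_iff_ball.1
    ((eventually_all.2 hg).and (hE.and hgη))
  set U := Metric.ball c ε with hU
  have hgd (r : R) : DifferentiableOn ℂ (g r) U := fun x hx =>
    ((hεs x hx).1 r).differentiableWithinAt
  let φ (x t : ℂ) : ℂ := t + ∑ r, ((max 0 (1 - ‖t - g r c‖ / δ) : ℝ) : ℂ) * (g r x - g r c)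
  have htent (x : ℂ) (hx : x ∈ U) := tent_homeomorph hδ hδs (hεs x hx).2.2
  have hφinj (x : ℂ) (hx : x ∈ U) : Function.Injective (φ x) := by
    obtain ⟨h, hh⟩ := (htent x hx).1
    exact (funext hh : ⇑h = φ x) ▸ h.injective
  have hφc (z : C(I, ℂ)) (hz : ∀ s, z s ∈ U) :
      Continuous fun q : I × ℂ => (z q.1, φ (z q.1) q.2) := by
    have (r : R) : Continuous fun q : I × ℂ => g r (z q.1) :=
      (hgd r).continuousOn.comp_continuous (by fun_prop) fun q => hz _
    exact Continuous.prodMk (by fun_prop) (continuous_snd.add (continuous_finsetSum _ fun r _ =>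
      Continuous.mul (by fun_prop) ((this r).sub continuous_const)))
  have hpath (z : C(I, ℂ)) (hz : ∀ s, z s ∈ U) (t : ℂ) (p : ℂ × ℂ)
      (hp : F p = (z 0, φ (z 0) t)) :
      ∃ γ : C(I, ℂ × ℂ), γ 0 = p ∧ ∀ s, F (γ s) = (z s, φ (z s) t) := by
    by_cases ht : ∃ r, t = g r c
    · obtain ⟨r, rfl⟩ := ht
      have hr (s : I) : φ (z s) (g r c) = g r (z s) := (htent _ (hz s)).2 r
      obtain ⟨τ, hτ, hτ0, hFτ⟩ := exists_lift_graph hF hF' hlift Metric.isOpen_ball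
        (convex_ball c ε) (hgd r) (δ := δ / 2) (by positivity) (fun x hx w hw hwδ hxE => by
          obtain ⟨s, hs⟩ := ((hεs x hx).2.1 _).1 hxE
          have hrs : r ≠ s := by
            rintro rfl
            exact hw (by simpa using hs)
          have h1 := hδs r s hrs
          have h2 := (hεs x hx).2.2 r
          have h3 := (hεs x hx).2.2 s
          have h4 : g r c - g s c = (g s x - g s c) - (g r x - g r c) - w := by
            linear_combination hs
          have h5 : ‖g r c - g s c‖ ≤ ‖g s x - g s c‖ + ‖g r x - g r c‖ + ‖w‖ := by
            rw [h4]
            exact (norm_sub_le _ _).trans (by gcongr; exact norm_sub_le _ _)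
          linarith) (hz 0) (hp.trans (by rw [hr]))
      exact ⟨⟨fun s => τ (z s), hτ.comp_continuous z.continuous hz⟩, hτ0, fun s => by
        simp only [ContinuousMap.coe_mk, hFτ _ (hz s), hr]⟩
    · refine hlift ⟨fun s => _, (hφc z hz).comp (Continuous.prodMk_left t)⟩ (fun s hs => ht ?_) p hp
      obtain ⟨r, hr⟩ := ((hεs _ (hz s)).2.1 _).1 hs
      exact ⟨r, hφinj _ (hz s) (hr.trans ((htent _ (hz s)).2 r).symm)⟩
  filter_upwards [Metric.ball_mem_nhds c hε] with c' hc'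
  have hcU : c ∈ U := Metric.mem_ball_self hε
  let z : C(I, ℂ) := ⟨fun s => c + (s : ℝ) • (c' - c), by fun_prop⟩
  have hz (s : I) : z s ∈ U := (convex_ball c ε).add_smul_sub_mem hcU hc' s.2
  have hz0 : z 0 = c := by simp [z]
  have hz1 : z 1 = c' := by simp [z]
  obtain ⟨h₀, hh₀⟩ := (htent c hcU).1
  obtain ⟨h₁, hh₁⟩ := (htent c' hc').1
  refine hloc.nonempty_homeomorph_of_lift ⟨_, hφc z hz⟩
    ⟨fun p => h₀.symm (F p).2, by fun_prop⟩ ⟨fun p => h₁.symm (F p).2, by fun_prop⟩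
    ?_ ?_ ?_ ?_ ?_ ?_ ?_ ?_
  · rintro ⟨p, hp⟩
    refine Prod.ext (hz0.trans hp.symm) ?_
    simp only [ContinuousMap.coe_mk, hz0]
    exact (hh₀ _).symm.trans (h₀.apply_symm_apply _)
  · rintro ⟨p, hp⟩
    refine Prod.ext (hz1.trans hp.symm) ?_
    simp only [ContinuousMap.coe_mk, hz1]
    exact (hh₁ _).symm.trans (h₁.apply_symm_apply _)
  · intro p y h
    exact (congrArg Prod.fst h).trans hz0
  · intro p y h
    exact (congrArg Prod.fst h).trans hz1
  · exact fun y y' h => hφinj _ (hz 0) (congrArg Prod.snd h)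
  · exact fun y y' h => hφinj _ (hz 1) (congrArg Prod.snd h)
  · exact fun y p h => hpath z hz y p h
  · intro y p h
    obtain ⟨γ, h1, h2⟩ := hpath (z.comp ⟨σ, continuous_symm⟩) (fun s => hz _) y p
      (by simpa using h)
    exact ⟨γ, h1, h2⟩

namespace Polynomial

/-- A nonconstant complex polynomial is surjective. -/
theorem exists_eval_eq (a : ℂ[X]) (ha : 0 < a.natDegree) (c : ℂ) : ∃ t, a.eval t = c := by
  have h : (a - C c).degree ≠ 0 := fun h0 => ha.ne' <| by
    rw [← natDegree_sub_C (a := c)]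
    exact natDegree_eq_of_degree_eq_some h0
  obtain ⟨t, ht⟩ := IsAlgClosed.exists_root _ h
  exact ⟨t, by simpa [sub_eq_zero] using ht⟩

/-- A simple root of `a - x` moves holomorphically with `x`. -/
theorem exists_root_branch (a : ℂ[X]) (t : ℂ) (ht : a.derivative.eval t ≠ 0) :
    ∃ τ : ℂ → ℂ, τ (a.eval t) = t ∧
      ∀ᶠ x in 𝓝 (a.eval t), a.eval (τ x) = x ∧ DifferentiableAt ℂ τ x := by
  have hs := a.hasStrictDerivAt t
  set e := (hs.hasStrictFDerivAt_equiv ht).toOpenPartialHomeomorph (fun x => a.eval x)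
  have hts : t ∈ e.source := (hs.hasStrictFDerivAt_equiv ht).mem_toOpenPartialHomeomorph_source
  have htt : a.eval t ∈ e.target :=
    (hs.hasStrictFDerivAt_equiv ht).image_mem_toOpenPartialHomeomorph_target
  have het : e.symm (a.eval t) = t := e.left_inv hts
  have hc : ContinuousAt e.symm (a.eval t) := e.continuousAt_symm htt
  have hne : ∀ᶠ x in 𝓝 (a.eval t), a.derivative.eval (e.symm x) ≠ 0 :=
    (a.derivative.continuous.continuousAt.comp hc).eventually_ne (by simpa [het] using ht)
  refine ⟨e.symm, het, ?_⟩
  filter_upwards [hne, e.open_target.mem_nhds htt] with x hx hxt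
  exact ⟨e.right_inv hxt,
    (e.hasDerivAt_symm hxt hx (a.hasDerivAt _)).differentiableAt⟩

/-- Near a regular value `c` of `a`, all solutions of `a = x` are given by the holomorphic
branches `τ t` through the solutions `t` of `a = c`. -/
theorem exists_root_branches {a : ℂ[X]} (ha : 0 < a.natDegree) {c : ℂ}
    (hc : ∀ t, a.eval t = c → a.derivative.eval t ≠ 0) :
    ∃ τ : ℂ → ℂ → ℂ,
      (∀ t, a.eval t = c → τ t c = t ∧ ∀ᶠ x in 𝓝 c, DifferentiableAt ℂ (τ t) x) ∧
      ∀ᶠ x in 𝓝 c, ∀ s, a.eval s = x ↔ ∃ t, a.eval t = c ∧ s = τ t x := by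
  have hbr (t : ℂ) : ∃ τ : ℂ → ℂ, a.eval t = c →
      τ c = t ∧ ∀ᶠ x in 𝓝 c, a.eval (τ x) = x ∧ DifferentiableAt ℂ τ x := by
    by_cases h : a.eval t = c
    · subst h
      obtain ⟨τ, h⟩ := exists_root_branch a t (hc t rfl)
      exact ⟨τ, fun _ => h⟩
    · exact ⟨0, fun h' => absurd h' h⟩
  choose τ hτ using hbr
  have hdeg (x : ℂ) : (a - C x).natDegree = a.natDegree := natDegree_sub_C
  have hne (x : ℂ) : a - C x ≠ 0 := ne_zero_of_natDegree_gt ((hdeg x).symm ▸ ha)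
  let R (x : ℂ) : Finset ℂ := (a - C x).roots.toFinset
  have hR (x t : ℂ) : t ∈ R x ↔ a.eval t = x := by
    simp [R, hne x, sub_eq_zero]
  have hcard (x : ℂ) : (R x).card ≤ a.natDegree :=
    (Multiset.toFinset_card_le _).trans ((card_roots' _).trans (hdeg x).le)
  have hcardc : (R c).card = a.natDegree := by
    have hnd : (a - C c).roots.Nodup := by
      rw [Multiset.nodup_iff_count_le_one]
      intro t
      rw [count_roots]
      by_contra! h
      have := (one_lt_rootMultiplicity_iff_isRoot (hne c)).1 h
      simp only [IsRoot.def, eval_sub, eval_C, sub_eq_zero, derivative_sub, derivative_C,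
        sub_zero] at this
      exact hc t this.1 this.2
    rw [Multiset.toFinset_card_of_nodup hnd,
      (splits_iff_card_roots.1 (IsAlgClosed.splits _)), hdeg]
  refine ⟨τ, fun t ht => ⟨(hτ t ht).1, (hτ t ht).2.mono fun x h => h.2⟩, ?_⟩
  have h1 : ∀ᶠ x in 𝓝 c, ∀ t ∈ R c, a.eval (τ t x) = x :=
    (Filter.eventually_all_finset _).2 fun t ht => (hτ t ((hR _ _).1 ht)).2.mono fun x h => h.1
  have h2 : ∀ᶠ x in 𝓝 c, ∀ t ∈ R c, ∀ s ∈ R c, t ≠ s → τ t x ≠ τ s x := by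
    refine (Filter.eventually_all_finset _).2 fun t ht =>
      (Filter.eventually_all_finset _).2 fun s hs => ?_
    by_cases hts : t = s
    · simp [hts]
    · have ht' := hτ t ((hR _ _).1 ht)
      have hs' := hτ s ((hR _ _).1 hs)
      have hne' : τ t c ≠ τ s c := by rwa [ht'.1, hs'.1]
      exact ((ht'.2.self_of_nhds.2.continuousAt.ne_iff_eventually_ne
        hs'.2.self_of_nhds.2.continuousAt).1 hne').mono fun x hx _ => hx
  filter_upwards [h1, h2] with x h1 h2 s
  constructor
  · intro hs
    obtain ⟨t, ht, hts⟩ := Finset.surjOn_of_injOn_of_card_le (s := R c) (t := R x) (fun t => τ t x)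
      (fun t ht => (hR _ _).2 (h1 t ht))
      (fun t ht t' ht' h => by_contra fun hne => h2 t ht t' ht' hne h)
      ((hcard x).trans hcardc.ge) ((hR x s).2 hs)
    exact ⟨t, (hR _ _).1 ht, hts.symm⟩
  · rintro ⟨t, ht, rfl⟩
    exact h1 t ((hR _ _).2 ht)

/-- If two families of polynomials `A`, `B` have no common root at one parameter `t₀`, then they
have one only at finitely many parameters, provided the degree of `A` is constant. -/
theorem finite_setOf_common_root {A B : ℂ[X][X]} (hA : ∀ t, A.leadingCoeff.eval t ≠ 0) {t₀ : ℂ}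
    (h : ∀ s, (A.map (evalRingHom t₀)).eval s = 0 → (B.map (evalRingHom t₀)).eval s ≠ 0) :
    {t | ∃ s, (A.map (evalRingHom t)).eval s = 0 ∧ (B.map (evalRingHom t)).eval s = 0}.Finite := by
  set r := resultant A B A.natDegree B.natDegree
  have hA0 (t : ℂ) : A.map (evalRingHom t) ≠ 0 := fun h => hA t <| by
    simpa using congrArg (coeff · A.natDegree) h
  have hr (t : ℂ) : r.eval t = 0 ↔
      ∃ s, (A.map (evalRingHom t)).eval s = 0 ∧ (B.map (evalRingHom t)).eval s = 0 := by
    have h1 := resultant_map_map A B A.natDegree B.natDegree (evalRingHom t)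
    have hd : (A.map (evalRingHom t)).natDegree = A.natDegree :=
      natDegree_map_of_leadingCoeff_ne_zero _ (hA t)
    rw [← hd, resultant_eq_prod_eval _ _ _ natDegree_map_le (IsAlgClosed.splits _), hd] at h1
    rw [← coe_evalRingHom, ← h1, mul_eq_zero, or_iff_right
      (pow_ne_zero _ (leadingCoeff_ne_zero.2 (hA0 t))), Multiset.prod_eq_zero_iff,
      Multiset.mem_map]
    simp only [mem_roots (hA0 t), IsRoot.def]
  have hr0 : r ≠ 0 := by
    intro h0
    obtain ⟨s, hs, hs'⟩ := (hr t₀).1 (by simp [h0])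
    exact h s hs hs'
  refine (r.roots.toFinset.finite_toSet).subset fun t ht => ?_
  simpa [hr0] using (hr t).2 ht

theorem finite_setOf_intersection {a b a' b' : ℂ[X]} (ha : 0 < a.natDegree)
    (ha' : 0 < a'.natDegree) {c : ℂ}
    (h : ∀ t s, a.eval t = c → a.eval t = a'.eval s → b.eval t ≠ b'.eval s) :
    {t | ∃ s, a.eval t = a'.eval s ∧ b.eval t = b'.eval s}.Finite := by
  obtain ⟨t₀, ht₀⟩ := a.exists_eval_eq ha c
  have hmap (p q : ℂ[X]) (t s : ℂ) :
      ((p.map C - C q).map (evalRingHom t)).eval s = p.eval s - q.eval t := by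
    have : (evalRingHom t).comp C = RingHom.id ℂ := by ext; simp
    simp [Polynomial.map_map, this]
  have hlc (t : ℂ) : (a'.map C - C a).leadingCoeff.eval t ≠ 0 := by
    have h1 : (a'.map (C : ℂ →+* ℂ[X])).natDegree = a'.natDegree :=
      natDegree_map_eq_of_injective C_injective _
    rw [leadingCoeff, natDegree_sub_C, h1]
    simp only [coeff_sub, coeff_map, coeff_C, ha'.ne', if_false, sub_zero, eval_C]
    exact leadingCoeff_ne_zero.2 (ne_zero_of_natDegree_gt ha')
  refine (finite_setOf_common_root (A := a'.map C - C a) (B := b'.map C - C b) hlc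
    (t₀ := t₀) fun s => ?_).subset fun t => ?_
  · simp only [hmap, sub_eq_zero, ne_eq]
    exact fun hs hs' => h t₀ s ht₀ hs.symm hs'.symm
  · rintro ⟨s, h1, h2⟩
    exact ⟨s, by rw [hmap, h1, sub_self], by rw [hmap, h2, sub_self]⟩

theorem finite_setOf_self_intersection {a b : ℂ[X]} (ha : 0 < a.natDegree) {c : ℂ}
    (hreg : ∀ t, a.eval t = c → a.derivative.eval t ≠ 0)
    (h : ∀ t s, a.eval t = c → t ≠ s → a.eval t = a.eval s → b.eval t ≠ b.eval s) :
    {t | ∃ s, t ≠ s ∧ a.eval t = a.eval s ∧ b.eval t = b.eval s}.Finite := by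
  obtain ⟨t₀, ht₀⟩ := a.exists_eval_eq ha c
  have hid (t : ℂ) : (evalRingHom t).comp C = RingHom.id ℂ := by ext; simp
  obtain ⟨A, hA⟩ : X - C X ∣ a.map (C : ℂ →+* ℂ[X]) - C a := by
    rw [dvd_iff_isRoot]
    simp [IsRoot.def, eval_map, eval₂_C_X]
  have hAt (t : ℂ) : a - C (a.eval t) = (X - C t) * A.map (evalRingHom t) := by
    simpa [Polynomial.map_map, hid] using congrArg (Polynomial.map (evalRingHom t)) hA
  have hAe (t s : ℂ) : a.eval s - a.eval t = (s - t) * (A.map (evalRingHom t)).eval s := by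
    simpa using congrArg (eval s) (hAt t)
  have hAd (t : ℂ) : (A.map (evalRingHom t)).eval t = a.derivative.eval t := by
    have := congrArg (eval t ∘ derivative) (hAt t)
    simpa using this.symm
  have hmap (p q : ℂ[X]) (t s : ℂ) :
      ((p.map C - C q).map (evalRingHom t)).eval s = p.eval s - q.eval t := by
    simp [Polynomial.map_map, hid]
  have hlc (t : ℂ) : A.leadingCoeff.eval t ≠ 0 := by
    have h1 : (a.map (C : ℂ →+* ℂ[X])).natDegree = a.natDegree :=
      natDegree_map_eq_of_injective C_injective _
    rw [← leadingCoeff_monic_mul (monic_X_sub_C X), ← hA, leadingCoeff, natDegree_sub_C, h1]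
    simp only [coeff_sub, coeff_map, coeff_C, ha.ne', if_false, sub_zero, eval_C]
    exact leadingCoeff_ne_zero.2 (ne_zero_of_natDegree_gt ha)
  refine (finite_setOf_common_root (A := A) (B := b.map C - C b) hlc
    (t₀ := t₀) fun s hs => ?_).subset fun t => ?_
  · rw [hmap, sub_ne_zero]
    have hne : t₀ ≠ s := by
      rintro rfl
      exact hreg t₀ ht₀ (by rw [← hAd, hs])
    have := hAe t₀ s
    rw [hs, mul_zero, sub_eq_zero] at this
    exact (h t₀ s ht₀ hne this.symm).symm
  · rintro ⟨s, hne, h1, h2⟩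
    refine ⟨s, ?_, by rw [hmap, h2, sub_self]⟩
    have := hAe t s
    rw [h1, sub_self, eq_comm, mul_eq_zero, sub_eq_zero] at this
    exact this.resolve_left hne.symm

end Polynomial

section Transversality

variable {ι : Type*}

/-- The vertical line through `c` meets the curves `t ↦ (α i t, β i t)` transversally. -/
structure IsTransversalAt (α β : ι → Polynomial ℂ) (c : ℂ) : Prop where
  derivative_ne_zero : ∀ i t, (α i).eval t = c → (α i).derivative.eval t ≠ 0
  injective : ∀ i t j s, (α i).eval t = c → (α j).eval s = c → (β i).eval t = (β j).eval s →
    (i, t) = (j, s)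

variable {α β : ι → Polynomial ℂ} {c : ℂ}

theorem Polynomial.finite_setOf_eval_eq {a : Polynomial ℂ} (ha : 0 < a.natDegree) (c : ℂ) :
    {t | a.eval t = c}.Finite := by
  have hne : a - Polynomial.C c ≠ 0 :=
    Polynomial.ne_zero_of_natDegree_gt (n := 0) (by rwa [Polynomial.natDegree_sub_C])
  refine (a - Polynomial.C c).roots.toFinset.finite_toSet.subset fun t ht => ?_
  simpa [hne, sub_eq_zero] using ht

/-- Transversality at one vertical line implies transversality at all but finitely many. -/
theorem IsTransversalAt.finite_setOf_not [Finite ι] (h : IsTransversalAt α β c)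
    (hα : ∀ i, 0 < (α i).natDegree) : {x | ¬ IsTransversalAt α β x}.Finite := by
  have h1 (i : ι) : {t | (α i).derivative.eval t = 0}.Finite := by
    have hne : (α i).derivative ≠ 0 := fun h0 =>
      (hα i).ne' (Polynomial.derivative_eq_zero.1 h0)
    refine (α i).derivative.roots.toFinset.finite_toSet.subset fun t ht => ?_
    simpa [hne] using ht
  have h2 (i j : ι) (hij : i ≠ j) :=
    Polynomial.finite_setOf_intersection (b := β i) (b' := β j) (hα i) (hα j) (c := c)
      fun t s ht hts hb => hij (Prod.ext_iff.1 (h.injective i t j s ht (hts ▸ ht) hb)).1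
  have h3 (i : ι) :=
    Polynomial.finite_setOf_self_intersection (b := β i) (hα i) (h.derivative_ne_zero i)
      fun t s ht hne hts hb => hne (Prod.ext_iff.1 (h.injective i t i s ht (hts ▸ ht) hb)).2
  refine (((Set.finite_iUnion fun i => (h1 i).image fun t => (α i).eval t).union
    (Set.finite_iUnion fun i => Set.finite_iUnion fun j => Set.finite_iUnion fun hij : i ≠ j =>
      (h2 i j hij).image fun t => (α i).eval t)).union
    (Set.finite_iUnion fun i => (h3 i).image fun t => (α i).eval t)).subset fun x hx => ?_
  contrapose! hx
  simp only [Set.mem_union, Set.mem_iUnion, Set.mem_image, Set.mem_ofPred_eq, not_or, not_exists,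
    not_and] at hx
  obtain ⟨⟨hx1, hx2⟩, hx3⟩ := hx
  simp only [Set.mem_ofPred_eq, not_not]
  refine ⟨fun i t ht h0 => hx1 i t h0 ht, fun i t j s ht hs hb => ?_⟩
  rcases eq_or_ne i j with rfl | hij
  · rcases eq_or_ne t s with rfl | hts
    · rfl
    · exact absurd ht (hx3 i t ⟨s, hts, ht.trans hs.symm, hb⟩)
  · exact absurd ht (hx2 i j hij t ⟨s, ht.trans hs.symm, hb⟩)

/-- Near a transversal vertical line, the union of the curves is a disjoint union of graphs of
holomorphic functions. -/
theorem IsTransversalAt.exists_graphs [Finite ι] (h : IsTransversalAt α β c)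
    (hα : ∀ i, 0 < (α i).natDegree) :
    ∃ g : {r : ι × ℂ // (α r.1).eval r.2 = c} → ℂ → ℂ,
      (∀ r, ∀ᶠ x in 𝓝 c, DifferentiableAt ℂ (g r) x) ∧
      (∀ᶠ x in 𝓝 c, ∀ y, (∃ i t, (α i).eval t = x ∧ (β i).eval t = y) ↔ ∃ r, y = g r x) ∧
      Function.Injective fun r => g r c := by
  choose τ hτ hroots using fun i =>
    Polynomial.exists_root_branches (hα i) (h.derivative_ne_zero i)
  refine ⟨fun r x => (β r.1.1).eval (τ r.1.1 r.1.2 x), fun r => ?_, ?_, ?_⟩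
  · filter_upwards [(hτ _ _ r.2).2] with x hx
    exact (β r.1.1).differentiableAt.comp x hx
  · filter_upwards [Filter.eventually_all.2 hroots] with x hx y
    constructor
    · rintro ⟨i, t, ht, rfl⟩
      obtain ⟨s, hs, rfl⟩ := (hx i t).1 ht
      exact ⟨⟨(i, s), hs⟩, rfl⟩
    · rintro ⟨⟨⟨i, s⟩, hs⟩, rfl⟩
      exact ⟨i, _, (hx i _).2 ⟨s, hs, rfl⟩, rfl⟩
  · rintro ⟨⟨i, t⟩, ht⟩ ⟨⟨j, s⟩, hs⟩ hb
    simp only [(hτ _ _ ht).1, (hτ _ _ hs).1] at hb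
    exact Subtype.ext (h.injective i t j s ht hs hb)

theorem finite_setOf_family_eval_eq [Finite ι] (hα : ∀ i, 0 < (α i).natDegree) (c : ℂ) :
    Finite {r : ι × ℂ // (α r.1).eval r.2 = c} := by
  have (i : ι) : Finite {t : ℂ // (α i).eval t = c} := Polynomial.finite_setOf_eval_eq (hα i) c
  exact Finite.of_injective
    (fun r => (⟨r.1.1, r.1.2, r.2⟩ : Σ i, {t : ℂ // (α i).eval t = c})) fun r s hrs => by
      obtain ⟨⟨i, t⟩, hr⟩ := r
      obtain ⟨⟨j, s⟩, hs⟩ := s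
      simp only [Sigma.mk.injEq] at hrs
      obtain ⟨rfl, hrs⟩ := hrs
      simpa using hrs

end Transversality

/-- if a Keller map restricts to a covering away from a curve `E`
which is a finite union of polynomially parametrized curves, and the vertical
line `L_c` meets `E` transversally, then the fiber `P = c` is a generic fiber. -/
theorem keller_transversal_line_generic_fiber
    (P Q : MvPolynomial (Fin 2) ℂ) (hK : IsKeller P Q)
    (ι : Type) [Fintype ι] (α β : ι → Polynomial ℂ)
    (hα : ∀ i, 0 < (α i).natDegree) (hβ : ∀ i, 0 < (β i).natDegree)
    (E : Set (ℂ × ℂ))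
    (hE : E = ⋃ i, Set.range (fun t : ℂ => ((α i).eval t, (β i).eval t)))
    (hcov : IsCoveringMap
      (fun p : (polyMap P Q ⁻¹' Eᶜ : Set (ℂ × ℂ)) =>
        (⟨polyMap P Q p.1, p.2⟩ : (Eᶜ : Set (ℂ × ℂ)))))
    (c : ℂ)
    (htrans : ∀ i : ι, ∀ t₀ : ℂ, (α i).eval t₀ = c →
      (Polynomial.derivative (α i)).eval t₀ ≠ 0)
    (hsep : ∀ i : ι, ∀ t₀ : ℂ, ∀ j : ι, ∀ t₁ : ℂ,
      (α i).eval t₀ = c → (α j).eval t₁ = c → (i, t₀) ≠ (j, t₁) →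
      ((α i).eval t₀, (β i).eval t₀) ≠ ((α j).eval t₁, (β j).eval t₁)) :
    ∃ S : Finset ℂ, ∀ c' ∉ S,
      Nonempty ({p : ℂ × ℂ // evalPoly P p = c'} ≃ₜ
                {p : ℂ × ℂ // evalPoly P p = c}) := by
  obtain ⟨F', hF, hF'⟩ := hK.exists_hasStrictFDerivAt_equiv
  have hmem (x y : ℂ) : (x, y) ∈ E ↔ ∃ i t, (α i).eval t = x ∧ (β i).eval t = y := by
    simp [hE]
  have hc : IsTransversalAt α β c := ⟨htrans, fun i t j s ht hs hb => by
    by_contra hne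
    exact hsep i t j s ht hs hne (Prod.ext (ht.trans hs.symm) hb)⟩
  have hfin := hc.finite_setOf_not hα
  refine ⟨hfin.toFinset, fun c' hc' => ?_⟩
  replace hc' : IsTransversalAt α β c' := by simpa using hc'
  have hconn : IsPreconnected {x | ¬ IsTransversalAt α β x}ᶜ :=
    (hfin.countable.isConnected_compl_of_one_lt_rank
      (by rw [Complex.rank_real_complex]; exact Nat.one_lt_ofNat)).isPreconnected
  refine hconn.induction₂ (fun x y => Nonempty
    ({p : ℂ × ℂ // evalPoly P p = x} ≃ₜ {p : ℂ × ℂ // evalPoly P p = y})) (fun x hx => ?_)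
    (fun _ _ _ _ _ _ ⟨e⟩ ⟨e'⟩ => ⟨e.trans e'⟩) (fun _ _ _ _ ⟨e⟩ => ⟨e.symm⟩)
    (not_not_intro hc') (not_not_intro hc)
  obtain ⟨g, hg, hgE, hginj⟩ := (not_not.1 hx : IsTransversalAt α β x).exists_graphs hα
  have := finite_setOf_family_eval_eq hα x
  simp only [← hmem] at hgE
  exact (eventually_nonempty_homeomorph_fiber hF hF'
    (exists_lift_of_isCoveringMap_compl hcov) hg hgE hginj).filter_mono nhdsWithin_le_nhds
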